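/- (Lemma 3.2: differentiating the semigroup equals the lifted semigroup applied to Df·U.) Let X̄_i denote the tangent lift of X_i to ℝ^d × M_d(ℝ), i.e. the first-order operator of directional derivative along (X_i(x), DX_i(x)U), and let L̄ := X̄_0 + (1/2)∑_{i=1}^m X̄_i ∘ X̄_i. Fix T > 0, e ∈ ℝ^d, and a smooth bounded f : ℝ^d → ℝ. Suppose: (i) F : [0,T] × ℝ^d → ℝ is smooth with all derivatives of polynomial growth and satisfies ∂_t F = L F with F(0,·) = f; (ii) Ψ : [0,T] × ℝ^d × M_d(ℝ) → ℝ is smooth with all derivatives of polynomial growth and satisfies ∂_t Ψ = L̄ Ψ with Ψ(0,x,U) = ⟨∇f(x), U e⟩; (iii) any two smooth solutions of ∂_t H = L̄ H on [0,T] × ℝ^d × M_d(ℝ) with the same initial condition and with all derivatives of polynomial growth coincide. Then Ψ(t,x,U) = ⟨∇_x F(t,x), U e⟩ for all (t,x,U); in particular Ψ(t,x,I) = ⟨∇_x F(t,x), e⟩, i.e. D P_t[f](x) = P̄_t[Df U](x, I) in semigroup notation. -/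

import Mathlib

open scoped BigOperators

/-- Bounded derivatives of all orders (order ≥ 1). -/
def BoundedDerivs {d : ℕ} (X : (Fin d → ℝ) → Fin d → ℝ) : Prop :=
  ∀ n : ℕ, 1 ≤ n → ∃ C : ℝ, ∀ x, ‖iteratedFDeriv ℝ n X x‖ ≤ C

/-- The Hörmander-type operator `L`. -/
noncomputable def hormanderL {d m : ℕ} (X : Fin (m + 1) → (Fin d → ℝ) → Fin d → ℝ)
    (f : (Fin d → ℝ) → ℝ) (x : Fin d → ℝ) : ℝ :=
  fderiv ℝ f x (X 0 x)
    + (1 / 2) * ∑ i : Fin m, fderiv ℝ f x (fderiv ℝ (X i.succ) x (X i.succ x))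
    + (1 / 2) * ∑ i : Fin m,
        fderiv ℝ (fun y => fderiv ℝ f y (X i.succ x)) x (X i.succ x)

/-- The tangent lift `X̄` of a vector field `X` to `ℝ^d × M_d(ℝ)` (matrices realized as
linear maps): the first-order operator of directional derivative along `(X(x), DX(x)U)`. -/
noncomputable def tangentLift {d : ℕ} (X : (Fin d → ℝ) → Fin d → ℝ)
    (F : (Fin d → ℝ) × ((Fin d → ℝ) →L[ℝ] (Fin d → ℝ)) → ℝ)
    (p : (Fin d → ℝ) × ((Fin d → ℝ) →L[ℝ] (Fin d → ℝ))) : ℝ :=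
  fderiv ℝ F p (X p.1, (fderiv ℝ X p.1).comp p.2)

/-- `L̄ := X̄₀ + ½ ∑ X̄ᵢ ∘ X̄ᵢ` acting on functions of `(x,U)`. -/
noncomputable def barL {d m : ℕ} (X : Fin (m + 1) → (Fin d → ℝ) → Fin d → ℝ)
    (F : (Fin d → ℝ) × ((Fin d → ℝ) →L[ℝ] (Fin d → ℝ)) → ℝ)
    (p : (Fin d → ℝ) × ((Fin d → ℝ) →L[ℝ] (Fin d → ℝ))) : ℝ :=
  tangentLift (X 0) F p
    + (1 / 2) * ∑ i : Fin m, tangentLift (X i.succ) (fun q => tangentLift (X i.succ) F q) p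

/-- `H : [0,T] × E → ℝ` is smooth with all derivatives of polynomial growth. -/
def SmoothPolyGrowth {E : Type*} [NormedAddCommGroup E] [NormedSpace ℝ E]
    (T : ℝ) (H : ℝ → E → ℝ) : Prop :=
  ContDiffOn ℝ (⊤ : ℕ∞) (fun p : ℝ × E => H p.1 p.2) (Set.Icc (0 : ℝ) T ×ˢ Set.univ) ∧
  ∀ n : ℕ, ∃ C : ℝ, ∃ q : ℕ, ∀ p ∈ Set.Icc (0 : ℝ) T ×ˢ (Set.univ : Set E),
    ‖iteratedFDerivWithin ℝ n (fun p : ℝ × E => H p.1 p.2)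
      (Set.Icc (0 : ℝ) T ×ˢ Set.univ) p‖ ≤ C * (1 + ‖p.2‖) ^ q

/-- `H` solves `∂ₜH = L̄H` on `[0,T]` in the class of smooth functions with all derivatives
of polynomial growth. -/
def IsPolySolBarL {d m : ℕ} (X : Fin (m + 1) → (Fin d → ℝ) → Fin d → ℝ) (T : ℝ)
    (H : ℝ → (Fin d → ℝ) × ((Fin d → ℝ) →L[ℝ] (Fin d → ℝ)) → ℝ) : Prop :=
  SmoothPolyGrowth T H ∧
  ∀ t ∈ Set.Icc (0 : ℝ) T, ∀ p,
    HasDerivWithinAt (fun s => H s p) (barL X (H t) p) (Set.Icc (0 : ℝ) T) t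


lemma two_le_aux : minSmoothness ℝ 2 ≤ ((⊤ : ℕ∞) : WithTop ℕ∞) := by
  rw [minSmoothness_of_isRCLikeNormedField]
  exact WithTop.coe_le_coe.2 (le_top : (2 : ℕ∞) ≤ ⊤)

/-- the lift of the differential -/
noncomputable def tildeD {d : ℕ} (e : Fin d → ℝ) (φ : (Fin d → ℝ) → ℝ)
    (p : (Fin d → ℝ) × ((Fin d → ℝ) →L[ℝ] (Fin d → ℝ))) : ℝ := fderiv ℝ φ p.1 (p.2 e)

noncomputable def vf {d : ℕ} (Y : (Fin d → ℝ) → Fin d → ℝ) (φ : (Fin d → ℝ) → ℝ)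
    (x : Fin d → ℝ) : ℝ := fderiv ℝ φ x (Y x)

lemma fderiv_smooth {d : ℕ} {φ : (Fin d → ℝ) → ℝ} (hφ : ContDiff ℝ (⊤ : ℕ∞) φ) :
    ContDiff ℝ (⊤ : ℕ∞) (fderiv ℝ φ) := hφ.fderiv_right (by simp)

lemma vf_smooth {d : ℕ} {Y : (Fin d → ℝ) → Fin d → ℝ} {φ : (Fin d → ℝ) → ℝ}
    (hY : ContDiff ℝ (⊤ : ℕ∞) Y) (hφ : ContDiff ℝ (⊤ : ℕ∞) φ) :
    ContDiff ℝ (⊤ : ℕ∞) (vf Y φ) := (fderiv_smooth hφ).clm_apply hY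

lemma fderiv_vf {d : ℕ} {Y : (Fin d → ℝ) → Fin d → ℝ} {φ : (Fin d → ℝ) → ℝ}
    (hY : ContDiff ℝ (⊤ : ℕ∞) Y) (hφ : ContDiff ℝ (⊤ : ℕ∞) φ) (x v : Fin d → ℝ) :
    fderiv ℝ (vf Y φ) x v = fderiv ℝ (fderiv ℝ φ) x v (Y x) + fderiv ℝ φ x (fderiv ℝ Y x v) := by
  have h1 := ((fderiv_smooth hφ).differentiable (by simp) x).hasFDerivAt
  have h2 := (hY.differentiable (by simp) x).hasFDerivAt
  have := (h1.clm_apply h2).fderiv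
  unfold vf
  rw [this]
  simp [add_comm]

lemma tangentLift_tildeD {d : ℕ} {Y : (Fin d → ℝ) → Fin d → ℝ} {φ : (Fin d → ℝ) → ℝ}
    (e : Fin d → ℝ)
    (hY : ContDiff ℝ (⊤ : ℕ∞) Y) (hφ : ContDiff ℝ (⊤ : ℕ∞) φ) :
    tangentLift Y (tildeD e φ) = tildeD e (vf Y φ) := by
  funext p
  have h1 := ((fderiv_smooth hφ).differentiable (by simp) p.1).hasFDerivAt
  have h1' := h1.comp p (hasFDerivAt_fst (𝕜 := ℝ) (p := p))
  have h2 : HasFDerivAt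
      (fun p : (Fin d → ℝ) × ((Fin d → ℝ) →L[ℝ] (Fin d → ℝ)) => p.2 e) _ p :=
    ((ContinuousLinearMap.apply ℝ (Fin d → ℝ) e).comp
      (ContinuousLinearMap.snd ℝ (Fin d → ℝ) ((Fin d → ℝ) →L[ℝ] (Fin d → ℝ)))).hasFDerivAt
  have h3 := (h1'.clm_apply h2).fderiv
  have hs : IsSymmSndFDerivAt ℝ φ p.1 :=
    (hφ.contDiffAt).isSymmSndFDerivAt two_le_aux
  unfold tangentLift
  have : tildeD e φ = fun p : (Fin d → ℝ) × ((Fin d → ℝ) →L[ℝ] (Fin d → ℝ)) =>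
      (fderiv ℝ φ ∘ Prod.fst) p (p.2 e) := rfl
  rw [this, h3, tildeD, fderiv_vf hY hφ, hs.eq]
  simp [add_comm]

lemma hormanderL_eq {d m : ℕ} {X : Fin (m + 1) → (Fin d → ℝ) → Fin d → ℝ}
    {φ : (Fin d → ℝ) → ℝ}
    (hX : ∀ i, ContDiff ℝ (⊤ : ℕ∞) (X i)) (hφ : ContDiff ℝ (⊤ : ℕ∞) φ) :
    hormanderL X φ = fun x => vf (X 0) φ x
      + (1/2) * ∑ i : Fin m, vf (X i.succ) (vf (X i.succ) φ) x := by
  funext x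
  have key : ∀ i : Fin m, vf (X i.succ) (vf (X i.succ) φ) x =
      fderiv ℝ φ x (fderiv ℝ (X i.succ) x (X i.succ x)) +
      fderiv ℝ (fun y => fderiv ℝ φ y (X i.succ x)) x (X i.succ x) := by
    intro i
    rw [vf, fderiv_vf (hX _) hφ, add_comm]
    congr 1
    have h1 := ((fderiv_smooth hφ).differentiable (by simp) x).hasFDerivAt
    rw [(h1.clm_apply (hasFDerivAt_const (X i.succ x) x)).fderiv]
    simp
  simp only [key, Finset.sum_add_distrib, hormanderL]
  rw [vf]
  ring

lemma barL_tildeD {d m : ℕ} {X : Fin (m + 1) → (Fin d → ℝ) → Fin d → ℝ}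
    {φ : (Fin d → ℝ) → ℝ} (e : Fin d → ℝ)
    (hX : ∀ i, ContDiff ℝ (⊤ : ℕ∞) (X i)) (hφ : ContDiff ℝ (⊤ : ℕ∞) φ) :
    barL X (tildeD e φ) = tildeD e (hormanderL X φ) := by
  funext p
  rw [hormanderL_eq hX hφ]
  have hd : ∀ i, HasFDerivAt (vf (X i) (vf (X i) φ)) _ p.1 := fun i =>
    ((vf_smooth (hX i) (vf_smooth (hX i) hφ)).differentiable (by simp) p.1).hasFDerivAt
  have h0 := ((vf_smooth (hX 0) hφ).differentiable (by simp) p.1).hasFDerivAt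
  have hs := h0.add ((HasFDerivAt.fun_sum (u := Finset.univ)
    (fun (i : Fin m) _ => hd i.succ)).const_mul (1/2))
  rw [tildeD]
  erw [hs.fderiv]
  simp only [barL, tangentLift_tildeD e (hX _) hφ]
  have : ∀ i : Fin m, tangentLift (X i.succ) (fun q => tildeD e (vf (X i.succ) φ) q) p =
    tildeD e (vf (X i.succ) (vf (X i.succ) φ)) p := fun i =>
      congrFun (tangentLift_tildeD e (hX _) (vf_smooth (hX _) hφ)) p
  simp only [this]
  simp [tildeD]

lemma norm_iter_const_le {V W : Type*} [NormedAddCommGroup V] [NormedSpace ℝ V]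
    [NormedAddCommGroup W] [NormedSpace ℝ W] (c : W) (s : Set V) (p : V) (j : ℕ) :
    ‖iteratedFDerivWithin ℝ j (fun _ : V => c) s p‖ ≤ ‖c‖ := by
  cases j with
  | zero => rw [norm_iteratedFDerivWithin_zero]
  | succ j => rw [iteratedFDerivWithin_succ_const]; simp

section growth

variable {E : Type*} [NormedAddCommGroup E] [NormedSpace ℝ E]

lemma slab_unique {T : ℝ} (hT : 0 < T) :
    UniqueDiffOn ℝ (Set.Icc (0 : ℝ) T ×ˢ (Set.univ : Set E)) :=
  (uniqueDiffOn_Icc hT).prod uniqueDiffOn_univ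

lemma slab_closure {T : ℝ} (hT : 0 < T) {p : ℝ × E}
    (hp : p ∈ Set.Icc (0 : ℝ) T ×ˢ (Set.univ : Set E)) :
    p ∈ closure (interior (Set.Icc (0 : ℝ) T ×ˢ (Set.univ : Set E))) := by
  rw [interior_prod_eq, closure_prod_eq, interior_Icc, closure_Ioo hT.ne]
  simpa using hp

lemma slice_hasFDerivAt {T : ℝ} {G : ℝ × E → ℝ} {G' : ℝ × E →L[ℝ] ℝ} {t : ℝ}
    (ht : t ∈ Set.Icc (0 : ℝ) T) {x : E}
    (hG : HasFDerivWithinAt G G' (Set.Icc (0 : ℝ) T ×ˢ (Set.univ : Set E)) (t, x)) :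
    HasFDerivAt (fun y => G (t, y)) (G'.comp (ContinuousLinearMap.inr ℝ ℝ E)) x :=
  hG.comp_hasFDerivAt x (hasFDerivAt_prodMk_right t x)
    (Filter.Eventually.of_forall fun y => ⟨ht, trivial⟩)

lemma time_hasDeriv {T : ℝ} {G : ℝ × E → ℝ} {G' : ℝ × E →L[ℝ] ℝ} {t : ℝ} {x : E}
    (hG : HasFDerivWithinAt G G' (Set.Icc (0 : ℝ) T ×ˢ (Set.univ : Set E)) (t, x)) :
    HasDerivWithinAt (fun s => G (s, x)) (G' (1, 0)) (Set.Icc (0 : ℝ) T) t := by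
  have h2 : HasDerivWithinAt (fun s : ℝ => (s, x)) ((1 : ℝ), (0 : E)) (Set.Icc (0 : ℝ) T) t :=
    (hasDerivWithinAt_id t _).prodMk (hasDerivWithinAt_const t _ x)
  have hm : Set.MapsTo (fun s : ℝ => (s, x)) (Set.Icc (0 : ℝ) T)
      (Set.Icc (0 : ℝ) T ×ˢ (Set.univ : Set E)) := fun s hs => ⟨hs, trivial⟩
  exact hG.comp_hasDerivWithinAt t h2 hm

lemma slice_smooth {T : ℝ} {H : ℝ → E → ℝ} (hH : SmoothPolyGrowth T H) {t : ℝ}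
    (ht : t ∈ Set.Icc (0 : ℝ) T) : ContDiff ℝ (⊤ : ℕ∞) (H t) := by
  rw [← contDiffOn_univ]
  exact hH.1.comp (f := fun y : E => (t, y)) (contDiff_prodMk_right t).contDiffOn
    (fun y _ => ⟨ht, trivial⟩)

/-- Polynomial growth of the lifted differential. -/
lemma lift_growth {T : ℝ} (hT : 0 < T) {H : ℝ → E → ℝ} (hH : SmoothPolyGrowth T H) (e : E) :
    SmoothPolyGrowth T (fun t (p : E × (E →L[ℝ] E)) => fderiv ℝ (H t) p.1 (p.2 e)) := by
  set G : ℝ × E → ℝ := fun p => H p.1 p.2 with hGdef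
  set S := Set.Icc (0 : ℝ) T ×ˢ (Set.univ : Set E) with hS
  set S' := Set.Icc (0 : ℝ) T ×ˢ (Set.univ : Set (E × (E →L[ℝ] E))) with hS'
  have uS : UniqueDiffOn ℝ S := slab_unique hT
  have uS' : UniqueDiffOn ℝ S' := slab_unique hT
  let ρ : ℝ × (E × (E →L[ℝ] E)) →L[ℝ] ℝ × E :=
    (ContinuousLinearMap.fst ℝ ℝ (E × (E →L[ℝ] E))).prod
      ((ContinuousLinearMap.fst ℝ E (E →L[ℝ] E)).comp
        (ContinuousLinearMap.snd ℝ ℝ (E × (E →L[ℝ] E))))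
  let lam : ℝ × (E × (E →L[ℝ] E)) →L[ℝ] ℝ × E :=
    (ContinuousLinearMap.inr ℝ ℝ E).comp ((ContinuousLinearMap.apply ℝ E e).comp
      ((ContinuousLinearMap.snd ℝ E (E →L[ℝ] E)).comp
        (ContinuousLinearMap.snd ℝ ℝ (E × (E →L[ℝ] E)))))
  have hpre : ρ ⁻¹' S = S' := by
    ext p; simp [ρ, hS, hS']
  have hA : ContDiffOn ℝ (⊤ : ℕ∞) (fderivWithin ℝ G S) S := hH.1.fderivWithin uS (by simp)
  have hAρ : ContDiffOn ℝ (⊤ : ℕ∞) (fderivWithin ℝ G S ∘ ρ) S' := by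
    rw [← hpre]; exact hA.comp_continuousLinearMap ρ
  have hlam : ContDiffOn ℝ (⊤ : ℕ∞) lam S' := lam.contDiff.contDiffOn
  have heq : Set.EqOn (fun p : ℝ × (E × (E →L[ℝ] E)) => fderiv ℝ (H p.1) p.2.1 (p.2.2 e))
      (fun p => (fderivWithin ℝ G S ∘ ρ) p (lam p)) S' := by
    rintro ⟨t, x, U⟩ hp
    have hd := ((hH.1.differentiableOn (by simp)) (t, x) ⟨hp.1, trivial⟩).hasFDerivWithinAt
    have := (slice_hasFDerivAt hp.1 hd).fderiv
    change fderiv ℝ (H t) x (U e) = _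
    change fderiv ℝ (H t) x = _ at this
    rw [this]
    rfl
  refine ⟨(hAρ.clm_apply hlam).congr heq, fun n => ?_⟩
  choose C q hC using hH.2
  -- uniform constants for the factors
  have hC0 : ∀ n, 0 ≤ C n := by
    intro n
    have := (norm_nonneg _).trans (hC n ((0 : ℝ), (0 : E)) ⟨⟨le_rfl, hT.le⟩, trivial⟩)
    simpa using this
  have b1 : ∀ i, ∀ p ∈ S', ‖iteratedFDerivWithin ℝ i (fderivWithin ℝ G S ∘ ρ) S' p‖ ≤
      C (i + 1) * (1 + ‖p.2‖) ^ q (i + 1) * ‖ρ‖ ^ i := by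
    intro i p hp
    have hp' : ρ p ∈ S := by rw [← hpre] at hp; exact hp
    have h1 := ρ.iteratedFDerivWithin_comp_right hA uS (hpre ▸ uS') hp' (i := i)
      (by exact_mod_cast le_top)
    rw [hpre] at h1
    rw [h1]
    refine (ContinuousMultilinearMap.norm_compContinuousLinearMap_le _ _).trans ?_
    rw [Finset.prod_const, Finset.card_univ, Fintype.card_fin,
      norm_iteratedFDerivWithin_fderivWithin uS hp']
    gcongr
    refine (hC (i + 1) _ hp').trans ?_
    have : ‖(ρ p).2‖ ≤ ‖p.2‖ := norm_fst_le p.2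
    have := hC0 (i + 1)
    gcongr
  have b2 : ∀ j, ∀ p ∈ S', ‖iteratedFDerivWithin ℝ j lam S' p‖ ≤
      (‖e‖ + ‖lam‖) * (1 + ‖p.2‖) := by
    intro j p hp
    have hn := norm_nonneg p.2
    match j with
    | 0 =>
      rw [norm_iteratedFDerivWithin_zero]
      have : ‖lam p‖ ≤ ‖e‖ * ‖p.2‖ := by
        have h0 : lam p = (0, p.2.2 e) := rfl
        have h1 : ‖lam p‖ = ‖p.2.2 e‖ := by rw [h0, Prod.norm_def]; simp
        rw [h1, mul_comm]
        exact (p.2.2.le_opNorm e).trans (by gcongr; exact norm_snd_le p.2)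
      refine this.trans ?_
      gcongr
      · exact le_add_of_nonneg_right (norm_nonneg lam)
      · linarith
    | j + 1 =>
      rw [← norm_iteratedFDerivWithin_fderivWithin uS' hp]
      have h1 : Set.EqOn (fderivWithin ℝ lam S') (fun _ => lam) S' := fun y hy =>
        lam.fderivWithin (uS' y hy)
      rw [iteratedFDerivWithin_congr h1 hp]
      have h2 : ‖iteratedFDerivWithin ℝ j (fun _ => lam) S' p‖ ≤ ‖lam‖ := by
        exact norm_iter_const_le lam S' p j
      refine h2.trans ?_
      have := norm_nonneg e
      have := norm_nonneg lam
      nlinarith [mul_nonneg (norm_nonneg e) hn, mul_nonneg (norm_nonneg lam) hn]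
  refine ⟨∑ i ∈ Finset.range (n + 1), (n.choose i : ℝ) * (C (i + 1) * ‖ρ‖ ^ i) * (‖e‖ + ‖lam‖),
    (∑ i ∈ Finset.range (n + 1), q (i + 1)) + 1, fun p hp => ?_⟩
  rw [iteratedFDerivWithin_congr heq hp]
  refine (norm_iteratedFDerivWithin_clm_apply hAρ hlam uS' hp (n := n)
    (by exact_mod_cast le_top)).trans ?_
  rw [Finset.sum_mul]
  refine Finset.sum_le_sum fun i hi => ?_
  have hC1 := hC0 (i + 1)
  have h1 : (1 : ℝ) ≤ 1 + ‖p.2‖ := by simp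
  have hq : q (i + 1) ≤ ∑ i ∈ Finset.range (n + 1), q (i + 1) :=
    Finset.single_le_sum (f := fun i => q (i + 1)) (fun _ _ => Nat.zero_le _) hi
  calc _ ≤ (n.choose i : ℝ) * (C (i + 1) * (1 + ‖p.2‖) ^ q (i + 1) * ‖ρ‖ ^ i) *
        ((‖e‖ + ‖lam‖) * (1 + ‖p.2‖)) := by
        gcongr
        · exact b1 i p hp
        · exact b2 _ p hp
    _ ≤ (n.choose i : ℝ) * (C (i + 1) * (1 + ‖p.2‖) ^ (∑ i ∈ Finset.range (n + 1), q (i + 1))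
        * ‖ρ‖ ^ i) * ((‖e‖ + ‖lam‖) * (1 + ‖p.2‖)) := by
        gcongr
    _ = _ := by ring

/-- Exchange of time and space derivatives. -/
lemma mixed_deriv {T : ℝ} (hT : 0 < T) {H K : ℝ → E → ℝ} (hH : SmoothPolyGrowth T H)
    (hK : ∀ t ∈ Set.Icc (0 : ℝ) T, ∀ x,
      HasDerivWithinAt (fun s => H s x) (K t x) (Set.Icc (0 : ℝ) T) t)
    {t : ℝ} (ht : t ∈ Set.Icc (0 : ℝ) T) (x v : E) :
    HasDerivWithinAt (fun s => fderiv ℝ (H s) x v) (fderiv ℝ (K t) x v)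
      (Set.Icc (0 : ℝ) T) t := by
  set G : ℝ × E → ℝ := fun p => H p.1 p.2 with hGdef
  set S := Set.Icc (0 : ℝ) T ×ˢ (Set.univ : Set E) with hS
  have uS : UniqueDiffOn ℝ S := slab_unique hT
  have hA : ContDiffOn ℝ (⊤ : ℕ∞) (fderivWithin ℝ G S) S := hH.1.fderivWithin uS (by simp)
  have hd : ∀ p ∈ S, HasFDerivWithinAt G (fderivWithin ℝ G S p) S p := fun p hp =>
    ((hH.1.differentiableOn (by simp)) p hp).hasFDerivWithinAt
  have hp : (t, x) ∈ S := ⟨ht, trivial⟩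
  have hd2 := ((hA.differentiableOn (by simp)) (t, x) hp).hasFDerivWithinAt
  have hsymm : IsSymmSndFDerivWithinAt ℝ G S (t, x) :=
    (hH.1 (t, x) hp).isSymmSndFDerivWithinAt two_le_aux uS (slab_closure hT hp) hp
  have e1 : ∀ s ∈ Set.Icc (0 : ℝ) T, fderiv ℝ (H s) x v = fderivWithin ℝ G S (s, x) (0, v) := by
    intro s hs
    have := (slice_hasFDerivAt hs (hd (s, x) ⟨hs, trivial⟩)).fderiv
    change fderiv ℝ (H s) x = _ at this
    rw [this]; rfl
  have e2 : K t = fun y => fderivWithin ℝ G S (t, y) (1, 0) := by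
    funext y
    exact (uniqueDiffOn_Icc hT t ht).eq_deriv _ (hK t ht y)
      (time_hasDeriv (hd (t, y) ⟨ht, trivial⟩))
  have g1 := hd2.clm_apply (hasFDerivWithinAt_const ((0 : ℝ), v) (t, x) S)
  have g2 := hd2.clm_apply (hasFDerivWithinAt_const ((1 : ℝ), (0 : E)) (t, x) S)
  have r1 := time_hasDeriv g1
  have r2 := (slice_hasFDerivAt ht g2).fderiv
  rw [e2, r2]
  refine (r1.congr e1 (e1 t ht)).congr_deriv ?_
  simpa using hsymm.eq (1, 0) (0, v)

end growth

/-- Lemma 3.2: `D P_t[f](x) = P̄_t[Df U](x, I)`; more precisely, the solution `Ψ` of the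
lifted equation with initial value `⟨∇f(x), U e⟩` equals `⟨∇ₓF(t,x), U e⟩` where `F` solves
`∂ₜF = LF`, `F(0,·) = f`. -/
theorem lifted_semigroup_differentiates (d m : ℕ) (hd : 0 < d) (hm : 0 < m)
    (X : Fin (m + 1) → (Fin d → ℝ) → Fin d → ℝ)
    (hXsmooth : ∀ i, ContDiff ℝ (⊤ : ℕ∞) (X i)) (hXbdd : ∀ i, BoundedDerivs (X i))
    (T : ℝ) (hT : 0 < T) (e : Fin d → ℝ)
    (f : (Fin d → ℝ) → ℝ) (hfsmooth : ContDiff ℝ (⊤ : ℕ∞) f) (hfbdd : ∃ C : ℝ, ∀ x, |f x| ≤ C)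
    -- (i) `F` solves `∂ₜF = LF`, `F(0,·) = f`, smooth with derivatives of polynomial growth
    (F : ℝ → (Fin d → ℝ) → ℝ)
    (hFreg : SmoothPolyGrowth T F)
    (hFpde : ∀ t ∈ Set.Icc (0 : ℝ) T, ∀ x,
      HasDerivWithinAt (fun s => F s x) (hormanderL X (F t) x) (Set.Icc (0 : ℝ) T) t)
    (hF0 : ∀ x, F 0 x = f x)
    -- (ii) `Ψ` solves `∂ₜΨ = L̄Ψ` with `Ψ(0,x,U) = ⟨∇f(x), U e⟩`, smooth with derivatives
    -- of polynomial growth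
    (Ψ : ℝ → (Fin d → ℝ) × ((Fin d → ℝ) →L[ℝ] (Fin d → ℝ)) → ℝ)
    (hΨ : IsPolySolBarL X T Ψ)
    (hΨ0 : ∀ (x : Fin d → ℝ) (U : (Fin d → ℝ) →L[ℝ] (Fin d → ℝ)),
      Ψ 0 (x, U) = fderiv ℝ f x (U e))
    -- (iii) uniqueness in this class
    (huniq : ∀ H₁ H₂ : ℝ → (Fin d → ℝ) × ((Fin d → ℝ) →L[ℝ] (Fin d → ℝ)) → ℝ,
      IsPolySolBarL X T H₁ → IsPolySolBarL X T H₂ → H₁ 0 = H₂ 0 →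
      ∀ t ∈ Set.Icc (0 : ℝ) T, H₁ t = H₂ t) :
    (∀ t ∈ Set.Icc (0 : ℝ) T, ∀ (x : Fin d → ℝ) (U : (Fin d → ℝ) →L[ℝ] (Fin d → ℝ)),
      Ψ t (x, U) = fderiv ℝ (F t) x (U e)) ∧
    (∀ t ∈ Set.Icc (0 : ℝ) T, ∀ x : Fin d → ℝ,
      Ψ t (x, ContinuousLinearMap.id ℝ (Fin d → ℝ)) = fderiv ℝ (F t) x e) := by
  have main : ∀ t ∈ Set.Icc (0 : ℝ) T, Ψ t = tildeD e (F t) := by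
    refine huniq Ψ (fun t => tildeD e (F t)) hΨ ⟨lift_growth hT hFreg e, ?_⟩ ?_
    · intro t ht p
      rw [barL_tildeD e hXsmooth (slice_smooth hFreg ht)]
      exact mixed_deriv hT hFreg hFpde ht p.1 (p.2 e)
    · funext p
      have : F 0 = f := funext hF0
      obtain ⟨x, U⟩ := p
      rw [hΨ0]
      simp only [this, tildeD]
  refine ⟨fun t ht x U => ?_, fun t ht x => ?_⟩
  · rw [main t ht, tildeD]
  · rw [main t ht, tildeD]; rfl
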